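/- arXiv:1912.01663 — 7 statements merged into one kernel-verified Lean document; each statement's English description precedes it below -/
import Mathlib

section
/- Let σ_m > 0, α > 0, let φ : ℝ → ℝ be a probability density supported in [0, σ_m], and let s ∈ ℂ with Re(s) ≥ 1 and φ*(s) ≠ 0, where φ*(s) = ∫₀^{σ_m} φ(z) z^{s−1} dz. Define H_s(λ) = 2 λ^{−2s} / (α φ*(s)) for λ > 0. Then for every σ > 0 the integral α ∫_{√(σ/σ_m)}^∞ φ(σ/λ²) · (H_s(λ)/λ) dλ converges absolutely and equals σ^{−s}. -/
open MeasureTheory Set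

/-- An integrable function cut off at `c` has a convergent Mellin transform on `1 ≤ re s`. -/
theorem mellinConvergent_indicator_Iio {f : ℝ → ℂ} (hf : Integrable f) (c : ℝ) {s : ℂ}
    (hs : 1 ≤ s.re) : MellinConvergent ((Iio c).indicator f) s := by
  have hsm : AEStronglyMeasurable (fun t : ℝ => (t : ℂ) ^ (s - 1))
      (volume.restrict (Ioi 0 ∩ Iio c)) :=
    (by fun_prop : Measurable fun t : ℝ => (t : ℂ) ^ (s - 1)).aestronglyMeasurable
  have hint : IntegrableOn (fun t : ℝ => (t : ℂ) ^ (s - 1) * f t) (Ioi 0 ∩ Iio c) := by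
    refine Integrable.bdd_mul (c := c ^ (s.re - 1)) hf.integrableOn hsm ?_
    refine (ae_restrict_iff' (measurableSet_Ioi.inter measurableSet_Iio)).2
      (Filter.Eventually.of_forall fun t ht => ?_)
    have ht0 : 0 < t := ht.1
    rw [Complex.norm_cpow_eq_rpow_re_of_pos ht0]
    exact Real.rpow_le_rpow ht0.le ht.2.le (by simpa using hs)
  have heq : (fun t : ℝ => (t : ℂ) ^ (s - 1) • (Iio c).indicator f t) =
      (Iio c).indicator fun t : ℝ => (t : ℂ) ^ (s - 1) * f t := by
    ext t
    by_cases h : t ∈ Iio c <;> simp [h]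
  rw [MellinConvergent, heq, IntegrableOn, integrable_indicator_iff measurableSet_Iio,
    IntegrableOn, Measure.restrict_restrict measurableSet_Iio, inter_comm]
  exact hint

/-- The Mellin transform of a function cut off at `c` is an integral over `(0, c]`. -/
theorem mellin_indicator_Iio (f : ℝ → ℂ) (c : ℝ) (s : ℂ) :
    mellin ((Iio c).indicator f) s = ∫ t in Ioc 0 c, f t * (t : ℂ) ^ (s - 1) := by
  have heq : (fun t : ℝ => (t : ℂ) ^ (s - 1) • (Iio c).indicator f t) =
      (Iio c).indicator fun t : ℝ => f t * (t : ℂ) ^ (s - 1) := by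
    ext t
    by_cases h : t ∈ Iio c <;> simp [h, mul_comm]
  rw [mellin, heq, setIntegral_indicator measurableSet_Iio, Ioi_inter_Iio,
    integral_Ioc_eq_integral_Ioo]

/-- Model solution for the random-plane operator: the power function
`H_s(λ) = 2 λ^(−2s) / (α φ*(s))` solves `K[H](σ) = σ^(−s)`, the integral
converging absolutely. -/
theorem plane_model_solution (σm α : ℝ) (hσm : 0 < σm) (hα : 0 < α)
    (φ : ℝ → ℝ)
    (hφ_meas : Measurable φ)
    (hφ_nn : ∀ᵐ x : ℝ, 0 ≤ φ x)
    (hφ_one : (∫ x : ℝ, φ x) = 1)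
    (hφ_supp : ∀ᵐ x : ℝ, x ∉ Set.Icc 0 σm → φ x = 0)
    (s : ℂ) (hs : 1 ≤ s.re)
    (Φ : ℂ) (hΦdef : Φ = ∫ z in Set.Ioc 0 σm, (φ z : ℂ) * (z : ℂ) ^ (s - 1))
    (hΦ : Φ ≠ 0)
    (H : ℝ → ℂ) (hH : ∀ lam : ℝ, H lam = 2 * (lam : ℂ) ^ (-2 * s) / ((α : ℂ) * Φ))
    (σ : ℝ) (hσ : 0 < σ) :
    IntegrableOn (fun lam : ℝ => (φ (σ / lam ^ 2) : ℂ) * (H lam / (lam : ℂ)))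
      (Set.Ioi (Real.sqrt (σ / σm))) ∧
    (α : ℂ) * (∫ lam in Set.Ioi (Real.sqrt (σ / σm)),
      (φ (σ / lam ^ 2) : ℂ) * (H lam / (lam : ℂ))) = (σ : ℂ) ^ (-s) := by
  have hφ : Integrable fun x => (φ x : ℂ) :=
    (not_imp_comm.1 integral_undef (by rw [hφ_one]; exact one_ne_zero)).ofReal
  set ψ : ℝ → ℂ := (Iio σm).indicator fun x => (φ x : ℂ) with hψ
  have hdiv : -2 * s / ((-2 : ℝ) : ℂ) = s := by
    push_cast
    field_simp
  have hconv : MellinConvergent (fun t : ℝ => ψ (σ * t ^ (-2 : ℝ))) (-2 * s) := by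
    rw [MellinConvergent.comp_rpow (f := fun t => ψ (σ * t)) (by norm_num), hdiv,
      MellinConvergent.comp_mul_left hσ]
    exact mellinConvergent_indicator_Iio hφ σm hs
  have hval : mellin (fun t : ℝ => ψ (σ * t ^ (-2 : ℝ))) (-2 * s) =
      (2 : ℂ)⁻¹ * ((σ : ℂ) ^ (-s) * Φ) := by
    rw [mellin_comp_rpow (fun t => ψ (σ * t)), hdiv, mellin_comp_mul_left _ _ hσ,
      mellin_indicator_Iio, ← hΦdef]
    simp
  have hkernel : ∀ t ∈ Ioi (0 : ℝ),
      (2 / ((α : ℂ) * Φ)) * ((t : ℂ) ^ (-2 * s - 1) • ψ (σ * t ^ (-2 : ℝ))) =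
      (Ioi (Real.sqrt (σ / σm))).indicator
        (fun lam : ℝ => (φ (σ / lam ^ 2) : ℂ) * (H lam / (lam : ℂ))) t := by
    intro t ht
    have ht0 : 0 < t := ht
    have hpow : σ * t ^ (-2 : ℝ) = σ / t ^ 2 := by
      rw [Real.rpow_neg ht0.le, Real.rpow_two, div_eq_mul_inv]
    have hmem : σ / t ^ 2 ∈ Iio σm ↔ t ∈ Ioi (Real.sqrt (σ / σm)) := by
      rw [mem_Iio, mem_Ioi, Real.sqrt_lt' ht0, div_lt_iff₀ (by positivity), div_lt_iff₀ hσm,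
        mul_comm]
    rw [hpow, hψ]
    by_cases h : t ∈ Ioi (Real.sqrt (σ / σm))
    · rw [indicator_of_mem h, indicator_of_mem (hmem.2 h), hH, smul_eq_mul,
        Complex.cpow_sub _ _ (Complex.ofReal_ne_zero.2 ht0.ne'), Complex.cpow_one]
      ring
    · rw [indicator_of_notMem h, indicator_of_notMem (mt hmem.1 h), smul_zero, mul_zero]
  have hinter : Ioi (0 : ℝ) ∩ Ioi (Real.sqrt (σ / σm)) = Ioi (Real.sqrt (σ / σm)) :=
    inter_eq_right.2 (Ioi_subset_Ioi (Real.sqrt_nonneg _))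
  constructor
  · have hint := (integrableOn_congr_fun hkernel measurableSet_Ioi).1
      (Integrable.const_mul hconv (2 / ((α : ℂ) * Φ)))
    rwa [IntegrableOn, integrable_indicator_iff measurableSet_Ioi, IntegrableOn,
      Measure.restrict_restrict measurableSet_Ioi, inter_comm, hinter] at hint
  · have hint := setIntegral_congr_fun (μ := volume) measurableSet_Ioi hkernel
    rw [setIntegral_indicator measurableSet_Ioi, hinter, integral_const_mul] at hint
    rw [← hint, ← mellin, hval]
    have hα' : (α : ℂ) ≠ 0 := Complex.ofReal_ne_zero.2 hα.ne'
    field_simp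
end

section
/- Let l_m > 0, β > 0, and let h, φ : ℝ → ℝ be probability densities supported in [0, l_m]. Let μ > 1 be such that φ*(μ + iν) ≠ 0 for every ν ∈ ℝ, and such that both ν ↦ h*(μ + iν) and ν ↦ h*(μ + iν)/φ*(μ + iν) belong to L¹(ℝ). Define, for λ > 0, H(λ) = (1/(β λ²)) · (λ^{−μ}/(2π)) ∫_ℝ (h*(μ + iν)/φ*(μ + iν)) λ^{−iν} dν. Then for almost every l > 0 the integral β ∫_{l/l_m}^∞ λ φ(l/λ) H(λ) dλ converges absolutely and equals h(l) (in particular h(l) = 0 there for l > l_m). -/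
open MeasureTheory Set

/-- The Mellin transform of a function supported in `[0, c]`. -/
noncomputable def mellinT (c : ℝ) (f : ℝ → ℝ) (s : ℂ) : ℂ :=
  ∫ z in Set.Ioc 0 c, (f z : ℂ) * (z : ℂ) ^ (s - 1)

open FourierTransform Complex in
/-- Fourier inversion almost everywhere, for an integrable function whose Fourier transform is
integrable. -/
theorem fourierInv_fourier_ae_eq {f : ℝ → ℂ} (hf : Integrable f) (hFf : Integrable (𝓕 f)) :
    ∀ᵐ x, 𝓕⁻ (𝓕 f) x = f x := by
  have hcont : Continuous (𝓕⁻ (𝓕 f)) :=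
    VectorFourier.fourierIntegral_continuous (L := -innerₗ ℝ) Real.continuous_fourierChar
      (by simpa using! continuous_inner.neg) hFf
  refine ae_eq_of_integral_contDiff_smul_eq hcont.locallyIntegrable hf.locallyIntegrable ?_
  intro g hg hgs
  have hgs' : HasCompactSupport (Complex.ofRealCLM ∘ g) := hgs.comp_left rfl
  let ψ : SchwartzMap ℝ ℂ := hgs'.toSchwartzMap (Complex.ofRealCLM.contDiff.comp hg)
  have hψ : ∀ x, ψ x = (g x : ℂ) := fun x => rfl
  have hflip : (-innerₗ ℝ).flip = -innerₗ ℝ := by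
    ext
    simp
  have h1 : ∫ x, 𝓕⁻ (ψ : ℝ → ℂ) x • 𝓕 f x = ∫ x, ψ x • 𝓕⁻ (𝓕 f) x := by
    have h := VectorFourier.integral_fourierIntegral_smul_eq_flip (L := -innerₗ ℝ)
      Real.continuous_fourierChar (by simpa using! continuous_inner.neg)
      (ψ.integrable (μ := volume)) hFf
    rw [hflip] at h
    exact h
  have h2 : ∫ x, 𝓕 ((𝓕⁻ ψ : SchwartzMap ℝ ℂ) : ℝ → ℂ) x • f x =
      ∫ x, (𝓕⁻ ψ : SchwartzMap ℝ ℂ) x • 𝓕 f x := by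
    simpa using! VectorFourier.integral_fourierIntegral_smul_eq_flip (L := innerₗ ℝ)
      Real.continuous_fourierChar continuous_inner
      ((𝓕⁻ ψ : SchwartzMap ℝ ℂ).integrable (μ := volume)) hf
  rw [← SchwartzMap.fourier_coe, FourierTransform.fourier_fourierInv_eq,
    SchwartzMap.fourierInv_coe, h1] at h2
  simpa [hψ] using h2.symm

open FourierTransform Complex in
/-- Mellin inversion almost everywhere. -/
theorem mellinInv_mellin_ae_eq (σ : ℝ) (f : ℝ → ℂ) (hf : MellinConvergent f σ)
    (hFf : VerticalIntegrable (mellin f) σ) :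
    ∀ᵐ x : ℝ, 0 < x → mellinInv σ (mellin f) x = f x := by
  let g := fun u : ℝ => Real.exp (-σ * u) • f (Real.exp (-u))
  have hg : Integrable g := by
    have himage : Real.exp ∘ Neg.neg '' univ = Ioi 0 := by
      rw [Set.image_comp, Set.image_univ_of_surjective neg_surjective, Set.image_univ,
        Real.range_exp]
    have hderiv : ∀ x ∈ (univ : Set ℝ),
        HasDerivWithinAt (Real.exp ∘ Neg.neg) (-Real.exp (-x)) univ x := fun x _ => by
      simpa using (Real.hasDerivAt_exp (-x)).comp x (hasDerivAt_neg x)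
    rw [MellinConvergent, ← himage, integrableOn_image_iff_integrableOn_abs_deriv_smul
      MeasurableSet.univ hderiv (Real.exp_injective.comp neg_injective).injOn,
      integrableOn_univ] at hf
    refine hf.congr (Filter.Eventually.of_forall fun x => ?_)
    have h1 : ((Real.exp (-x) : ℝ) : ℂ) ^ ((σ : ℂ) - 1) =
        ((Real.exp (-x * (σ - 1)) : ℝ) : ℂ) := by
      rw [← Complex.ofReal_one, ← Complex.ofReal_sub, ← Complex.ofReal_cpow (Real.exp_pos _).le,
        ← Real.exp_mul]
    simp only [g, Function.comp, h1, abs_neg, Real.abs_exp, Complex.real_smul, smul_eq_mul]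
    rw [← mul_assoc, ← Complex.ofReal_mul, ← Real.exp_add]
    ring_nf
  have h2π : 2 * Real.pi ≠ 0 := by simp
  have hFg : Integrable (𝓕 g) := by
    have : Integrable (𝓕 (fun u ↦ Real.exp (-(σ * u)) • f (Real.exp (-u)))) := by
      simpa [VerticalIntegrable, mellin_eq_fourier, mul_div_cancel_right₀ _ h2π]
        using hFf.comp_mul_right' h2π
    simpa only [g, neg_mul] using this
  have hnull := addHaar_image_eq_zero_of_differentiableOn_of_addHaar_eq_zero volume
    (f := fun x => Real.exp (-x)) (by fun_prop) (fourierInv_fourier_ae_eq hg hFg)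
  filter_upwards [compl_mem_ae_iff.mpr hnull] with x hx hx0
  have key : 𝓕⁻ (𝓕 g) (-Real.log x) = g (-Real.log x) := by
    by_contra hne
    exact hx ⟨-Real.log x, hne, by simp [Real.exp_log hx0]⟩
  calc
    mellinInv σ (mellin f) x
      = mellinInv σ (fun s ↦ 𝓕 g (s.im / (2 * Real.pi))) x := by
      simp [g, mellinInv, mellin_eq_fourier]
    _ = (x : ℂ) ^ (-σ : ℂ) • g (-Real.log x) := by
      rw [mellinInv_eq_fourierInv _ _ hx0, ← key]
      simp [mul_div_cancel_left₀ _ h2π]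
    _ = (x : ℂ) ^ (-σ : ℂ) • Real.exp (σ * Real.log x) • f (Real.exp (Real.log x)) := by simp [g]
    _ = f x := by
      have : ((Real.exp (σ * Real.log x) : ℝ) : ℂ) = (x : ℂ) ^ (σ : ℂ) := by
        rw [← Complex.ofReal_cpow hx0.le, Real.rpow_def_of_pos hx0, mul_comm]
      rw [Real.exp_log hx0, Complex.real_smul, this, smul_eq_mul, ← mul_assoc,
        ← Complex.cpow_add _ _ (by exact_mod_cast hx0.ne')]
      simp

/-- The multiplicative convolution of `f` with the inverse Mellin transform of `Q` is the inverse
Mellin transform of the product `mellin f * Q`. -/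
theorem integral_inv_mul_comp_div_mul_mellinInv {f : ℝ → ℂ} {σ : ℝ} (hf : MellinConvergent f σ)
    {Q : ℂ → ℂ} (hQ : Complex.VerticalIntegrable Q σ) {l : ℝ} (hl : 0 < l) :
    IntegrableOn (fun t : ℝ => (t : ℂ)⁻¹ * f (l / t) * mellinInv σ Q t) (Ioi 0) ∧
      ∫ t in Ioi (0 : ℝ), (t : ℂ)⁻¹ * f (l / t) * mellinInv σ Q t =
        mellinInv σ (fun s => mellin f s * Q s) l := by
  let A : ℝ → ℂ := fun t => (t : ℂ) ^ (-(σ : ℂ) - 1) * f (l * t⁻¹)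
  let E : ℝ × ℝ → ℂ := fun p => Complex.exp ((-(p.2 * Real.log p.1) : ℝ) * Complex.I)
  let F : ℝ × ℝ → ℂ := fun p => E p * (A p.1 * Q (σ + p.2 * Complex.I))
  have hA : IntegrableOn A (Ioi 0) := by
    have h1 : MellinConvergent (fun t : ℝ => f (l * t ^ (-1 : ℝ))) (-(σ : ℂ)) := by
      rw [MellinConvergent.comp_rpow (f := fun t => f (l * t)) (by norm_num),
        MellinConvergent.comp_mul_left hl]
      simpa using hf
    simpa only [MellinConvergent, Real.rpow_neg_one, smul_eq_mul] using h1
  have hE : Measurable E := by fun_prop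
  have hF : Integrable F ((volume.restrict (Ioi 0)).prod volume) := by
    refine (hA.mul_prod hQ).bdd_mul (c := 1) hE.aestronglyMeasurable ?_
    exact Filter.Eventually.of_forall fun p => (Complex.norm_exp_ofReal_mul_I _).le
  have hcpow : ∀ t : ℝ, 0 < t → ∀ ν : ℝ,
      E (t, ν) = (t : ℂ) ^ (-((ν : ℂ) * Complex.I)) := fun t ht ν => by
    rw [Complex.cpow_def_of_ne_zero (by exact_mod_cast ht.ne'), ← Complex.ofReal_log ht.le]
    simp only [E]
    push_cast
    ring_nf
  have hFt : ∀ t : ℝ, 0 < t → ∀ ν : ℝ, F (t, ν) =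
      (t : ℂ)⁻¹ * f (l / t) *
        ((t : ℂ) ^ (-((σ : ℂ) + ν * Complex.I)) • Q (σ + ν * Complex.I)) := fun t ht ν => by
    have ht' : (t : ℂ) ≠ 0 := by exact_mod_cast ht.ne'
    simp only [F, A, hcpow t ht, smul_eq_mul, neg_add, div_eq_mul_inv]
    rw [Complex.cpow_sub _ _ ht', Complex.cpow_add _ _ ht', Complex.cpow_one]
    ring
  have hleft : ∀ t ∈ Ioi (0 : ℝ), (1 / (2 * Real.pi) : ℝ) • ∫ ν, F (t, ν) =
      (t : ℂ)⁻¹ * f (l / t) * mellinInv σ Q t := fun t ht => by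
    simp_rw [hFt t ht, mellinInv, integral_const_mul, mul_smul_comm]
  have hright : ∀ ν : ℝ, ∫ t in Ioi (0 : ℝ), F (t, ν) =
      (l : ℂ) ^ (-((σ : ℂ) + ν * Complex.I)) •
        (mellin f (σ + ν * Complex.I) * Q (σ + ν * Complex.I)) := fun ν => by
    have h1 : ∀ t ∈ Ioi (0 : ℝ), F (t, ν) =
        ((t : ℂ) ^ (-((σ : ℂ) + ν * Complex.I) - 1) • f (l * t⁻¹)) *
          Q (σ + ν * Complex.I) := fun t ht => by
      have ht' : (t : ℂ) ≠ 0 := by exact_mod_cast (ne_of_gt ht)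
      simp only [F, A, hcpow t ht, smul_eq_mul, neg_add]
      rw [Complex.cpow_sub _ _ ht', Complex.cpow_sub _ _ ht', Complex.cpow_add _ _ ht']
      ring
    have h2 := mellin_comp_inv (fun t => f (l * t)) (-((σ : ℂ) + ν * Complex.I))
    rw [neg_neg, mellin_comp_mul_left _ _ hl, mellin] at h2
    rw [setIntegral_congr_fun measurableSet_Ioi h1, integral_mul_const, h2, smul_mul_assoc]
  refine ⟨(IntegrableOn.congr_fun (hF.integral_prod_left.smul (1 / (2 * Real.pi) : ℝ)) hleft
    measurableSet_Ioi), ?_⟩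
  rw [← setIntegral_congr_fun measurableSet_Ioi hleft, integral_smul,
    integral_integral_swap hF, mellinInv]
  simp_rw [hright]

/-- An integrable function on `(0, c]`, extended by zero, has a convergent Mellin transform on
`1 ≤ re s`. -/
theorem mellinConvergent_indicator_Ioc {f : ℝ → ℂ} (hf : Integrable f) (c : ℝ) {s : ℂ}
    (hs : 1 ≤ s.re) : MellinConvergent ((Ioc 0 c).indicator f) s := by
  have h1 : IntegrableOn (fun t : ℝ => (t : ℂ) ^ (s - 1) * f t) (Ioc 0 c) := by
    refine hf.integrableOn.bdd_mul (c := c ^ (s.re - 1)) ?_ ?_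
    · exact (by fun_prop : Measurable fun t : ℝ => (t : ℂ) ^ (s - 1)).aestronglyMeasurable
    · filter_upwards [ae_restrict_mem measurableSet_Ioc] with t ht
      rw [Complex.norm_cpow_eq_rpow_re_of_pos ht.1]
      simpa using Real.rpow_le_rpow ht.1.le ht.2 (sub_nonneg.mpr hs)
  have h2 : (fun t : ℝ => (t : ℂ) ^ (s - 1) • (Ioc 0 c).indicator f t) =
      (Ioc 0 c).indicator fun t : ℝ => (t : ℂ) ^ (s - 1) * f t := by
    ext t
    by_cases ht : t ∈ Ioc 0 c <;> simp [ht]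
  rw [MellinConvergent, h2]
  exact (h1.integrable_indicator measurableSet_Ioc).integrableOn

theorem mellinT_eq_mellin_indicator (c : ℝ) (f : ℝ → ℝ) (s : ℂ) :
    mellinT c f s = mellin ((Ioc 0 c).indicator fun x => (f x : ℂ)) s := by
  have h2 : (fun t : ℝ => (t : ℂ) ^ (s - 1) • (Ioc 0 c).indicator (fun x => (f x : ℂ)) t) =
      (Ioc 0 c).indicator fun t : ℝ => (f t : ℂ) * (t : ℂ) ^ (s - 1) := by
    ext t
    by_cases ht : t ∈ Ioc 0 c <;> simp [ht, mul_comm]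
  rw [mellin, h2, setIntegral_indicator measurableSet_Ioc,
    inter_eq_right.mpr fun x hx => hx.1, mellinT]

/-- Existence part of the Proposition (Random lines): the inverse-Mellin formula
`H(λ) = (1/(β λ²)) (λ^(−μ)/(2π)) ∫ (h*/φ*)(μ+iν) λ^(−iν) dν` solves the
random-line equation `β ∫_{l/l_m}^∞ λ φ(l/λ) H(λ) dλ = h(l)` for a.e. `l > 0`. -/
theorem line_existence (lm β : ℝ) (hlm : 0 < lm) (hβ : 0 < β)
    (h φ : ℝ → ℝ)
    (hh_meas : Measurable h)
    (hh_nn : ∀ᵐ x : ℝ, 0 ≤ h x)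
    (hh_one : (∫ x : ℝ, h x) = 1)
    (hh_supp : ∀ᵐ x : ℝ, x ∉ Set.Icc 0 lm → h x = 0)
    (hφ_meas : Measurable φ)
    (hφ_nn : ∀ᵐ x : ℝ, 0 ≤ φ x)
    (hφ_one : (∫ x : ℝ, φ x) = 1)
    (hφ_supp : ∀ᵐ x : ℝ, x ∉ Set.Icc 0 lm → φ x = 0)
    (μ : ℝ) (hμ : 1 < μ)
    (hφne : ∀ ν : ℝ, mellinT lm φ ((μ : ℂ) + ν * Complex.I) ≠ 0)
    (hL1h : Integrable (fun ν : ℝ => mellinT lm h ((μ : ℂ) + ν * Complex.I)))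
    (hL1q : Integrable (fun ν : ℝ =>
      mellinT lm h ((μ : ℂ) + ν * Complex.I) / mellinT lm φ ((μ : ℂ) + ν * Complex.I)))
    (H : ℝ → ℂ)
    (hH : ∀ lam : ℝ, 0 < lam → H lam =
      ((1 / (β * lam ^ 2) * (lam ^ (-μ) / (2 * Real.pi)) : ℝ) : ℂ) *
        ∫ ν : ℝ, (mellinT lm h ((μ : ℂ) + ν * Complex.I) /
            mellinT lm φ ((μ : ℂ) + ν * Complex.I)) *
          (lam : ℂ) ^ (-(ν : ℂ) * Complex.I)) :
    ∀ᵐ l : ℝ, 0 < l →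
      (IntegrableOn (fun lam : ℝ => (lam : ℂ) * (φ (l / lam) : ℂ) * H lam)
          (Set.Ioi (l / lm)) ∧
        (β : ℂ) * (∫ lam in Set.Ioi (l / lm),
          (lam : ℂ) * (φ (l / lam) : ℂ) * H lam) = (h l : ℂ)) := by
  have integrable_of_one : ∀ f : ℝ → ℝ, (∫ x, f x) = 1 → Integrable fun x => (f x : ℂ) :=
    fun f hf => Integrable.ofReal <| by
      by_contra hn
      simp [integral_undef hn] at hf
  simp_rw [mellinT_eq_mellin_indicator] at hφne hL1h hL1q hH
  set hc : ℝ → ℂ := (Ioc 0 lm).indicator fun x => (h x : ℂ)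
  set φc : ℝ → ℂ := (Ioc 0 lm).indicator fun x => (φ x : ℂ) with hφc
  have hconv : MellinConvergent hc μ :=
    mellinConvergent_indicator_Ioc (integrable_of_one h hh_one) lm (by simpa using hμ.le)
  have φconv : MellinConvergent φc μ :=
    mellinConvergent_indicator_Ioc (integrable_of_one φ hφ_one) lm (by simpa using hμ.le)
  have hH' : ∀ t : ℝ, 0 < t → H t =
      (β : ℂ)⁻¹ * ((t : ℂ)⁻¹ * (t : ℂ)⁻¹ * mellinInv μ (fun s => mellin hc s / mellin φc s) t) :=
    fun t ht => by
      have ht' : (t : ℂ) ≠ 0 := by exact_mod_cast ht.ne'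
      have hsplit : ∫ ν : ℝ, (t : ℂ) ^ (-((μ : ℂ) + ν * Complex.I)) •
          (mellin hc (μ + ν * Complex.I) / mellin φc (μ + ν * Complex.I)) =
          ((t ^ (-μ) : ℝ) : ℂ) * ∫ ν : ℝ, mellin hc (μ + ν * Complex.I) /
            mellin φc (μ + ν * Complex.I) * (t : ℂ) ^ (-(ν : ℂ) * Complex.I) := by
        rw [← integral_const_mul]
        refine integral_congr_ae (Filter.Eventually.of_forall fun ν => ?_)
        have hadd : -((μ : ℂ) + ν * Complex.I) = ((-μ : ℝ) : ℂ) + -(ν : ℂ) * Complex.I := by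
          push_cast
          ring
        simp only [hadd, Complex.cpow_add _ _ ht', Complex.ofReal_cpow ht.le, smul_eq_mul]
        ring
      rw [hH t ht, mellinInv, hsplit]
      rw [Complex.real_smul]
      push_cast
      ring
  filter_upwards [mellinInv_mellin_ae_eq μ hc hconv hL1h, hh_supp] with l hl hsupp hl0
  obtain ⟨hint, hval⟩ := integral_inv_mul_comp_div_mul_mellinInv φconv
    (Q := fun s => mellin hc s / mellin φc s) hL1q hl0
  have hval' : ∫ t in Ioi (0 : ℝ), (t : ℂ)⁻¹ * φc (l / t) *
      mellinInv μ (fun s => mellin hc s / mellin φc s) t = h l := by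
    rw [hval, mellinInv]
    simp_rw [mul_div_cancel₀ _ (hφne _)]
    rw [← mellinInv, hl hl0]
    by_cases hlm' : l ≤ lm
    · exact indicator_of_mem (show l ∈ Ioc 0 lm from ⟨hl0, hlm'⟩) _
    · rw [hsupp fun hmem => hlm' hmem.2]
      simp [hc, hlm']
  have hl_lm : 0 < l / lm := div_pos hl0 hlm
  have heq : EqOn
      (fun t : ℝ => (Ici (l / lm)).indicator (fun t : ℝ => (t : ℂ) * (φ (l / t) : ℂ) * H t) t)
      (fun t : ℝ => (β : ℂ)⁻¹ * ((t : ℂ)⁻¹ * φc (l / t) *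
        mellinInv μ (fun s => mellin hc s / mellin φc s) t)) (Ioi 0) := fun t ht => by
    have ht0 : 0 < t := ht
    have ht' : (t : ℂ) ≠ 0 := by exact_mod_cast ht0.ne'
    have hmem : l / t ∈ Ioc 0 lm ↔ t ∈ Ici (l / lm) := by
      rw [mem_Ioc, mem_Ici, div_le_iff₀ ht0, div_le_iff₀ hlm, mul_comm lm]
      exact and_iff_right (div_pos hl0 ht0)
    by_cases hm : t ∈ Ici (l / lm)
    · simp only [indicator_of_mem hm, hφc, indicator_of_mem (hmem.mpr hm), hH' t ht0]
      field_simp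
    · simp only [indicator_of_notMem hm, hφc, indicator_of_notMem (mt hmem.mp hm)]
      simp
  have hsub : Ioi (0 : ℝ) ∩ Ici (l / lm) = Ici (l / lm) :=
    inter_eq_right.mpr fun t ht => hl_lm.trans_le ht
  have hint' := (IntegrableOn.congr_fun (hint.const_mul (β : ℂ)⁻¹) heq.symm measurableSet_Ioi)
  constructor
  · rw [← integrableOn_Ici_iff_integrableOn_Ioi]
    rw [IntegrableOn, integrable_indicator_iff measurableSet_Ici, IntegrableOn,
      Measure.restrict_restrict measurableSet_Ici, inter_comm, hsub] at hint'
    exact hint'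
  · rw [← integral_Ici_eq_integral_Ioi, ← hsub, ← setIntegral_indicator measurableSet_Ici,
      setIntegral_congr_fun measurableSet_Ioi heq, integral_const_mul, hval',
      mul_inv_cancel_left₀ (by exact_mod_cast hβ.ne')]
end

section
/- Let l_m > 0, β > 0, and let h, φ : ℝ → ℝ be probability densities supported in [0, l_m], with φ*(μ + iν) ≠ 0 for every ν ∈ ℝ for some μ > 1. Suppose H₁, H₂ : (0, ∞) → ℂ are measurable functions with ∫₀^∞ λ^{μ+1} |H_j(λ)| dλ < ∞ for j = 1, 2, and that for almost every l > 0 both integrals β ∫_{l/l_m}^∞ λ φ(l/λ) H_j(λ) dλ converge absolutely and equal h(l) (where h(l) = 0 for l > l_m). Then H₁ = H₂ almost everywhere on (0, ∞). -/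
open MeasureTheory Set

open scoped FourierTransform in
/-- The Fourier transform is injective on integrable functions on the real line. -/
theorem ae_eq_zero_of_fourier_eq_zero {f : ℝ → ℂ} (hf : Integrable f)
    (h : ∀ w, 𝓕 f w = 0) : ∀ᵐ x, f x = 0 := by
  apply ae_eq_zero_of_integral_contDiff_smul_eq_zero hf.locallyIntegrable
  intro g g_smooth g_cpt
  have hg₁ : HasCompactSupport (Complex.ofRealCLM ∘ g) := g_cpt.comp_left rfl
  have hg₂ : ContDiff ℝ (↑(⊤ : ℕ∞)) (Complex.ofRealCLM ∘ g) := by fun_prop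
  set G : SchwartzMap ℝ ℂ := hg₁.toSchwartzMap hg₂
  have key := VectorFourier.integral_fourierIntegral_smul_eq_flip (μ := volume) (ν := volume)
    (L := innerₗ ℝ) Real.continuous_fourierChar continuous_inner hf
    ((𝓕⁻ G : SchwartzMap ℝ ℂ).integrable (μ := volume))
  have h1 : VectorFourier.fourierIntegral Real.fourierChar volume (innerₗ ℝ) f = 0 := by
    ext w; exact h w
  have h2 : VectorFourier.fourierIntegral Real.fourierChar volume (innerₗ ℝ).flip
      (𝓕⁻ G : SchwartzMap ℝ ℂ) = G := by
    have h3 : 𝓕 (𝓕⁻ G) = G := FourierTransform.fourier_fourierInv_eq G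
    rw [flip_innerₗ]
    conv_rhs => rw [← h3]
    rw [SchwartzMap.fourier_coe]
    rfl
  rw [h1, h2] at key
  simp only [Pi.zero_apply, smul_eq_mul, zero_mul, integral_zero] at key
  refine Eq.trans (integral_congr_ae (Filter.Eventually.of_forall fun x => ?_)) key.symm
  simp [G, mul_comm]

/-- The Mellin transform on a vertical line of convergence is injective. -/
theorem ae_eq_zero_of_mellin_eq_zero {f : ℝ → ℂ} {σ : ℝ} (hf : MellinConvergent f σ)
    (h : ∀ t : ℝ, mellin f (σ + t * Complex.I) = 0) : ∀ᵐ x : ℝ, 0 < x → f x = 0 := by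
  set F : ℝ → ℂ := fun u => Real.exp (-σ * u) • f (Real.exp (-u)) with hF
  have hderiv : ∀ x ∈ (univ : Set ℝ), HasDerivWithinAt (fun u : ℝ => Real.exp (-u))
      (-Real.exp (-x)) univ x := fun x _ => by
    simpa only [mul_neg_one] using ((hasDerivAt_neg x).exp).hasDerivWithinAt
  have hinj : InjOn (fun u : ℝ => Real.exp (-u)) univ := fun x _ y _ hxy => by
    simpa using hxy
  have himg : (fun u : ℝ => Real.exp (-u)) '' univ = Ioi 0 := by
    ext y
    simp only [image_univ, mem_range, mem_Ioi]
    exact ⟨fun ⟨u, hu⟩ => hu ▸ Real.exp_pos _, fun hy => ⟨-Real.log y, by simp [Real.exp_log hy]⟩⟩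
  have hFi : Integrable F := by
    have := hf
    rw [MellinConvergent, ← himg, integrableOn_image_iff_integrableOn_abs_deriv_smul
      MeasurableSet.univ hderiv hinj, integrableOn_univ] at this
    refine this.congr (Filter.Eventually.of_forall fun u => ?_)
    have hc : ((Real.exp (-u) : ℝ) : ℂ) ^ ((σ : ℂ) - 1) = (Real.exp (-u * (σ - 1)) : ℝ) := by
      rw [Real.exp_mul, Complex.ofReal_cpow (Real.exp_pos _).le]
      push_cast; rfl
    simp only [hF, hc, abs_neg, abs_of_pos (Real.exp_pos _), Complex.real_smul, smul_eq_mul]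
    rw [← mul_assoc, ← Complex.ofReal_mul, ← Real.exp_add]
    ring_nf
  have hF0 : ∀ᵐ u, F u = 0 := by
    refine ae_eq_zero_of_fourier_eq_zero hFi fun w => ?_
    have := h (2 * Real.pi * w)
    rw [mellin_eq_fourier] at this
    have e : (2 * Real.pi * w) / (2 * Real.pi) = w := by field_simp
    simpa [hF, e] using this
  have hnull : volume ((fun u : ℝ => Real.exp (-u)) '' {u | ¬ F u = 0}) = 0 := by
    apply addHaar_image_eq_zero_of_differentiableOn_of_addHaar_eq_zero
    · fun_prop
    · exact hF0
  refine measure_mono_null (fun x hx => ?_) hnull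
  simp only [mem_ofPred_eq, mem_compl_iff, not_forall] at hx
  obtain ⟨hx0, hx1⟩ := hx
  refine ⟨-Real.log x, ?_, by simp [Real.exp_log hx0]⟩
  simpa [hF, Real.exp_log hx0] using hx1

/-- The Mellin transform of a multiplicative convolution is the product of Mellin transforms. -/
theorem mellin_integral_comp_div_mul {φ G : ℝ → ℂ} (hφm : Measurable φ) (hGm : Measurable G)
    {s : ℂ} (hφ : MellinConvergent φ s) (hG : MellinConvergent G (s + 1)) :
    mellin (fun l => ∫ x in Ioi (0 : ℝ), φ (l / x) * G x) s = mellin φ s * mellin G (s + 1) := by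
  have hinner : ∀ x ∈ Ioi (0 : ℝ), ∫ l in Ioi (0 : ℝ), (l : ℂ) ^ (s - 1) * (φ (l / x) * G x)
      = mellin φ s * ((x : ℂ) ^ (s + 1 - 1) • G x) := fun x hx => by
    have hx' : (0 : ℝ) < x⁻¹ := inv_pos.2 hx
    have := mellin_comp_mul_right φ s hx'
    simp only [mellin, smul_eq_mul, ← div_eq_mul_inv] at this
    simp_rw [← mul_assoc]
    rw [integral_mul_const, this, mellin]
    have e : ((x⁻¹ : ℝ) : ℂ) ^ (-s) = (x : ℂ) ^ s := by
      rw [Complex.ofReal_inv, Complex.inv_cpow, Complex.cpow_neg, inv_inv]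
      rw [Complex.arg_ofReal_of_nonneg (le_of_lt hx)]
      exact Real.pi_pos.ne
    simp only [e, smul_eq_mul, add_sub_cancel_right]
    ring
  have hnorm : ∀ x ∈ Ioi (0 : ℝ),
      ∫ l in Ioi (0 : ℝ), ‖(l : ℂ) ^ (s - 1) * (φ (l / x) * G x)‖
      = (∫ l in Ioi (0 : ℝ), ‖(l : ℂ) ^ (s - 1) • φ l‖) * ‖(x : ℂ) ^ (s + 1 - 1) • G x‖ :=
    fun x hx => by
    have hx0 : (0 : ℝ) < x := hx
    have hx' : (0 : ℝ) < x⁻¹ := inv_pos.2 hx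
    have := integral_comp_mul_left_Ioi (fun l : ℝ => ‖(l : ℂ) ^ (s - 1) • φ l‖) 0 hx'
    rw [mul_zero, inv_inv] at this
    have e : EqOn (fun l : ℝ => ‖(l : ℂ) ^ (s - 1) * (φ (l / x) * G x)‖)
        (fun l : ℝ => ‖((x⁻¹ * l : ℝ) : ℂ) ^ (s - 1) • φ (x⁻¹ * l)‖ * (x ^ (s.re - 1) * ‖G x‖))
        (Ioi 0) := fun l hl => by
      have hl0 : (0 : ℝ) < l := hl
      simp only [norm_mul, norm_smul, Complex.norm_cpow_eq_rpow_re_of_pos hl0,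
        Complex.norm_cpow_eq_rpow_re_of_pos (mul_pos hx' hl0), Complex.sub_re, Complex.one_re]
      rw [Real.mul_rpow hx'.le hl0.le, Real.inv_rpow hx0.le, div_eq_inv_mul]
      have : x ^ (s.re - 1) ≠ 0 := (Real.rpow_pos_of_pos hx0 _).ne'
      field_simp
    rw [setIntegral_congr_fun measurableSet_Ioi e, integral_mul_const, this, norm_smul,
      Complex.norm_cpow_eq_rpow_re_of_pos hx0, smul_eq_mul, add_sub_cancel_right,
      Real.rpow_sub_one hx0.ne']
    field_simp
  have hint : Integrable (Function.uncurry fun l x : ℝ => (l : ℂ) ^ (s - 1) * (φ (l / x) * G x))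
      ((volume.restrict (Ioi 0)).prod (volume.restrict (Ioi 0))) := by
    rw [integrable_prod_iff' (by
      apply Measurable.aestronglyMeasurable
      unfold Function.uncurry
      fun_prop)]
    refine ⟨?_, ?_⟩
    · refine (ae_restrict_iff' measurableSet_Ioi).2 (Filter.Eventually.of_forall fun x hx => ?_)
      have hx' : (0 : ℝ) < x⁻¹ := inv_pos.2 hx
      have := (((MellinConvergent.comp_mul_left hx').2 hφ).integrable).mul_const (G x)
      refine this.congr (Filter.Eventually.of_forall fun l => ?_)
      simp [div_eq_inv_mul, mul_assoc]
    · have := (hG.norm).const_mul (∫ l in Ioi (0 : ℝ), ‖(l : ℂ) ^ (s - 1) • φ l‖)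
      refine this.congr ?_
      refine (ae_restrict_iff' measurableSet_Ioi).2 (Filter.Eventually.of_forall fun x hx => ?_)
      exact (hnorm x hx).symm
  calc mellin (fun l => ∫ x in Ioi (0 : ℝ), φ (l / x) * G x) s
      = ∫ l in Ioi (0 : ℝ), ∫ x in Ioi (0 : ℝ), (l : ℂ) ^ (s - 1) * (φ (l / x) * G x) := by
        simp only [mellin, smul_eq_mul, integral_const_mul]
    _ = ∫ x in Ioi (0 : ℝ), ∫ l in Ioi (0 : ℝ), (l : ℂ) ^ (s - 1) * (φ (l / x) * G x) :=
        integral_integral_swap hint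
    _ = ∫ x in Ioi (0 : ℝ), mellin φ s * ((x : ℂ) ^ (s + 1 - 1) • G x) :=
        setIntegral_congr_fun measurableSet_Ioi hinner
    _ = mellin φ s * mellin G (s + 1) := integral_const_mul _ _

/-- Uniqueness part of the Proposition (Random lines): two solutions of the
random-line equation with `∫₀^∞ λ^(μ+1) |H_j(λ)| dλ < ∞` agree a.e. on `(0,∞)`. -/
theorem line_uniqueness (lm β : ℝ) (hlm : 0 < lm) (hβ : 0 < β)
    (h φ : ℝ → ℝ)
    (hh_meas : Measurable h)
    (hh_nn : ∀ᵐ x : ℝ, 0 ≤ h x)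
    (hh_one : (∫ x : ℝ, h x) = 1)
    (hh_supp : ∀ᵐ x : ℝ, x ∉ Set.Icc 0 lm → h x = 0)
    (hφ_meas : Measurable φ)
    (hφ_nn : ∀ᵐ x : ℝ, 0 ≤ φ x)
    (hφ_one : (∫ x : ℝ, φ x) = 1)
    (hφ_supp : ∀ᵐ x : ℝ, x ∉ Set.Icc 0 lm → φ x = 0)
    (μ : ℝ) (hμ : 1 < μ)
    (hφne : ∀ ν : ℝ, mellinT lm φ ((μ : ℂ) + ν * Complex.I) ≠ 0)
    (H₁ H₂ : ℝ → ℂ) (hm1 : Measurable H₁) (hm2 : Measurable H₂)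
    (hi1 : IntegrableOn (fun lam : ℝ => lam ^ (μ + 1) * ‖H₁ lam‖) (Set.Ioi 0))
    (hi2 : IntegrableOn (fun lam : ℝ => lam ^ (μ + 1) * ‖H₂ lam‖) (Set.Ioi 0))
    (heq1 : ∀ᵐ l : ℝ, 0 < l →
      (IntegrableOn (fun lam : ℝ => (lam : ℂ) * (φ (l / lam) : ℂ) * H₁ lam)
          (Set.Ioi (l / lm)) ∧
        (β : ℂ) * (∫ lam in Set.Ioi (l / lm),
          (lam : ℂ) * (φ (l / lam) : ℂ) * H₁ lam) = (h l : ℂ)))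
    (heq2 : ∀ᵐ l : ℝ, 0 < l →
      (IntegrableOn (fun lam : ℝ => (lam : ℂ) * (φ (l / lam) : ℂ) * H₂ lam)
          (Set.Ioi (l / lm)) ∧
        (β : ℂ) * (∫ lam in Set.Ioi (l / lm),
          (lam : ℂ) * (φ (l / lam) : ℂ) * H₂ lam) = (h l : ℂ))) :
    ∀ᵐ lam : ℝ, 0 < lam → H₁ lam = H₂ lam := by
  set ψ : ℝ → ℂ := (Ioc 0 lm).indicator (fun x => (φ x : ℂ)) with hψ
  set G : ℝ → ℂ := fun x => (x : ℂ) * (H₁ x - H₂ x) with hGdef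
  have hψm : Measurable ψ :=
    (Complex.measurable_ofReal.comp hφ_meas).indicator measurableSet_Ioc
  have hGm : Measurable G := by fun_prop
  have hφi : Integrable φ := by
    by_contra hc
    simp [integral_undef hc] at hφ_one
  have hψmellin : ∀ s, mellin ψ s = mellinT lm φ s := fun s => by
    have e : (fun t : ℝ => (t : ℂ) ^ (s - 1) • ψ t)
        = (Ioc 0 lm).indicator (fun t => (φ t : ℂ) * (t : ℂ) ^ (s - 1)) := by
      ext t
      by_cases ht : t ∈ Ioc 0 lm <;> simp [hψ, ht, mul_comm]
    rw [mellin, mellinT, e, setIntegral_indicator measurableSet_Ioc,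
      inter_eq_self_of_subset_right Ioc_subset_Ioi_self]
  have hψconv : ∀ t : ℝ, MellinConvergent ψ (μ + t * Complex.I) := fun t => by
    have hb : Integrable (fun x => lm ^ (μ - 1) * ‖φ x‖) := hφi.norm.const_mul _
    refine Integrable.mono' hb.integrableOn (by
      apply Measurable.aestronglyMeasurable
      fun_prop) ?_
    refine (ae_restrict_iff' measurableSet_Ioi).2 (Filter.Eventually.of_forall fun x hx => ?_)
    have hx0 : (0 : ℝ) < x := hx
    by_cases hxm : x ∈ Ioc 0 lm
    · rw [norm_smul, Complex.norm_cpow_eq_rpow_re_of_pos hx0]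
      simp only [hψ, indicator_of_mem hxm, Complex.norm_real]
      have : ((μ : ℂ) + t * Complex.I - 1).re = μ - 1 := by simp
      rw [this]
      have := Real.rpow_le_rpow hx0.le hxm.2 (by linarith : 0 ≤ μ - 1)
      gcongr
    · simp only [hψ, indicator_of_notMem hxm, smul_zero, norm_zero]
      positivity
  have hGconv : ∀ t : ℝ, MellinConvergent G (μ + t * Complex.I + 1) := fun t => by
    refine (hi1.add hi2).mono' (by
      apply Measurable.aestronglyMeasurable
      fun_prop) ?_
    refine (ae_restrict_iff' measurableSet_Ioi).2 (Filter.Eventually.of_forall fun x hx => ?_)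
    have hx0 : (0 : ℝ) < x := hx
    rw [norm_smul, Complex.norm_cpow_eq_rpow_re_of_pos hx0]
    have : ((μ : ℂ) + t * Complex.I + 1 - 1).re = μ := by simp
    rw [this, hGdef, norm_mul, Complex.norm_real, Real.norm_of_nonneg hx0.le, ← mul_assoc,
      ← Real.rpow_add_one hx0.ne']
    simp only [Pi.add_apply]
    rw [← mul_add]
    gcongr
    exact norm_sub_le _ _
  have hconv : ∀ᵐ l : ℝ, 0 < l → ∫ x in Ioi (0 : ℝ), ψ (l / x) * G x = 0 := by
    filter_upwards [heq1, heq2] with l h1 h2 hl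
    obtain ⟨i1, e1⟩ := h1 hl
    obtain ⟨i2, e2⟩ := h2 hl
    have e : EqOn (fun x => ψ (l / x) * G x) ((Ici (l / lm)).indicator
        (fun x : ℝ => (x : ℂ) * (φ (l / x) : ℂ) * H₁ x - (x : ℂ) * (φ (l / x) : ℂ) * H₂ x))
        (Ioi 0) := fun x hx => by
      have hx0 : (0 : ℝ) < x := hx
      by_cases hxl : l / lm ≤ x
      · have : l / x ∈ Ioc 0 lm := ⟨div_pos hl hx0, (div_le_comm₀ hlm hx0).1 hxl⟩
        simp only [hψ, hGdef, indicator_of_mem this, indicator_of_mem (mem_Ici.2 hxl)]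
        ring
      · have : l / x ∉ Ioc 0 lm := fun hm => hxl ((div_le_comm₀ hlm hx0).2 hm.2)
        simp [hψ, this, hxl]
    rw [setIntegral_congr_fun measurableSet_Ioi e, setIntegral_indicator measurableSet_Ici,
      inter_eq_self_of_subset_right (Ici_subset_Ioi.2 (div_pos hl hlm)),
      integral_Ici_eq_integral_Ioi, integral_sub i1 i2, sub_eq_zero]
    exact mul_left_cancel₀ (Complex.ofReal_ne_zero.2 hβ.ne') (e1.trans e2.symm)
  have hG0 : ∀ t : ℝ, mellin G (μ + t * Complex.I + 1) = 0 := fun t => by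
    have key := mellin_integral_comp_div_mul hψm hGm (hψconv t) (hGconv t)
    have hz : mellin (fun l => ∫ x in Ioi (0 : ℝ), ψ (l / x) * G x) (μ + t * Complex.I) = 0 := by
      refine integral_eq_zero_of_ae ((ae_restrict_iff' measurableSet_Ioi).2 ?_)
      filter_upwards [hconv] with l hl hl0
      simp [hl hl0]
    rw [hz, hψmellin] at key
    exact (mul_eq_zero.1 key.symm).resolve_left (hφne t)
  have hfin : ∀ᵐ x : ℝ, 0 < x → G x = 0 := by
    refine ae_eq_zero_of_mellin_eq_zero (σ := μ + 1) (by simpa using hGconv 0) fun t => ?_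
    rw [← hG0 t]
    push_cast
    ring_nf
  filter_upwards [hfin] with x hx hx0
  have := hx hx0
  simp only [hGdef, mul_eq_zero, Complex.ofReal_eq_zero, hx0.ne', false_or] at this
  exact sub_eq_zero.1 this
end

section
/- Under the hypotheses of the random-line existence proposition, suppose additionally that ν ↦ h*(μ + iν)/φ*(μ + iν) belongs to L^p(ℝ) for some p ∈ (1, 2]. Let q = p/(p−1) and let H be the solution H(λ) = (1/(β λ²)) · (λ^{−μ}/(2π)) ∫_ℝ (h*(μ + iν)/φ*(μ + iν)) λ^{−iν} dν. Then ∫₀^∞ λ^{μ q − 1} |λ² H(λ)|^q dλ < ∞, i.e. λ ↦ λ² H(λ) belongs to the weighted space L^q with weight λ^{μq−1} on (0, ∞). -/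
open MeasureTheory Set

open scoped FourierTransform ContDiff

theorem continuous_fourier_of_integrable {f : ℝ → ℂ} (hf : Integrable f) : Continuous (𝓕 f) :=
  VectorFourier.fourierIntegral_continuous Real.continuous_fourierChar
    (by exact continuous_inner) hf

theorem integral_fourier_mul_eq_flip {f g : ℝ → ℂ} (hf : Integrable f) (hg : Integrable g) :
    ∫ ξ, 𝓕 f ξ * g ξ = ∫ x, f x * 𝓕 g x := by
  simpa using! (VectorFourier.integral_fourierIntegral_smul_eq_flip (L := innerₗ ℝ)
    Real.continuous_fourierChar continuous_inner hf hg)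

/-- The integral Fourier transform agrees with the `L²` Fourier transform on `L¹ ∩ L²`. -/
theorem fourier_toLp_two_ae_eq {f : ℝ → ℂ} (hf : Integrable f) (hf2 : MemLp f 2) :
    (𝓕 (hf2.toLp f) : Lp ℂ 2 (volume : Measure ℝ)) =ᵐ[volume] 𝓕 f := by
  apply ae_eq_of_integral_contDiff_smul_eq
  · exact (Lp.memLp _).locallyIntegrable (by norm_num)
  · exact (continuous_fourier_of_integrable hf).locallyIntegrable
  · intro g hg hgs
    have hgs' : HasCompactSupport (fun x => (g x : ℂ)) := hgs.comp_left (g := Complex.ofReal) rfl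
    have hg' : ContDiff ℝ ∞ (fun x => (g x : ℂ)) := Complex.ofRealCLM.contDiff.comp hg
    let G : SchwartzMap ℝ ℂ := hgs'.toSchwartzMap hg'
    have hG : ∀ x, G x = g x := fun x => rfl
    have key := DFunLike.congr_fun (Lp.fourier_toTemperedDistribution_eq (hf2.toLp f)) G
    rw [TemperedDistribution.fourier_apply, Lp.toTemperedDistribution_apply,
      Lp.toTemperedDistribution_apply] at key
    calc _ = ∫ x, G x • (𝓕 (hf2.toLp f) : Lp ℂ 2 (volume : Measure ℝ)) x := by
          simp [hG]
      _ = ∫ x, (𝓕 G) x • (hf2.toLp f) x := key.symm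
      _ = ∫ x, f x * 𝓕 (G : ℝ → ℂ) x := by
          apply integral_congr_ae
          filter_upwards [hf2.coeFn_toLp] with x hx
          rw [hx, SchwartzMap.fourier_coe, smul_eq_mul, mul_comm]
      _ = ∫ x, 𝓕 f x * G x := (integral_fourier_mul_eq_flip hf G.integrable).symm
      _ = _ := by simp [hG, mul_comm]

/-- The `L²` bound in Plancherel's theorem for integrable functions. -/
theorem lintegral_enorm_fourier_sq_le {f : ℝ → ℂ} (hf : Integrable f) :
    ∫⁻ ξ, ‖𝓕 f ξ‖ₑ ^ 2 ≤ ∫⁻ x, ‖f x‖ₑ ^ 2 := by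
  have hpow (g : ℝ → ℂ) : ∫⁻ x, ‖g x‖ₑ ^ 2 = eLpNorm g 2 volume ^ 2 := by
    have := eLpNorm_nnreal_pow_eq_lintegral (p := 2) (f := g) (μ := volume) (by norm_num)
    simpa using this.symm
  by_cases hfin : ∫⁻ x, ‖f x‖ₑ ^ 2 = ⊤
  · simp [hfin]
  have hf2 : MemLp f 2 := ⟨hf.1, by
    rw [hpow] at hfin
    exact lt_top_iff_ne_top.2 fun h => hfin (by simp [h])⟩
  rw [hpow, hpow, ← eLpNorm_congr_ae (fourier_toLp_two_ae_eq hf hf2), ← Lp.enorm_def,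
    ← eLpNorm_congr_ae hf2.coeFn_toLp, ← Lp.enorm_def]
  apply le_of_eq
  rw [← ofReal_norm, ← ofReal_norm, Lp.norm_fourier_eq]

/-- A weak-type estimate: the part of `f` where `f` is large contributes at most `t / 2` to the
Fourier transform, and the remaining part is controlled in `L²`. -/
theorem measure_lt_norm_fourier_le {f : ℝ → ℂ} (hfm : Measurable f) (hf : Integrable f) {p B : ℝ}
    (hp : 1 < p) (hB : 0 < B) (hA : ∫⁻ x, ENNReal.ofReal (‖f x‖ ^ p) ≤ ENNReal.ofReal B)
    {t : ℝ} (ht : 0 < t) :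
    volume {ξ | t < ‖𝓕 f ξ‖} ≤ ENNReal.ofReal (4 / t ^ 2) *
      ∫⁻ x, {x | t ≤ 2 * B * ‖f x‖ ^ (1 - p)}.indicator (fun x => ‖f x‖ₑ ^ 2) x := by
  set E := {x | t ≤ 2 * B * ‖f x‖ ^ (1 - p)}
  have hE : MeasurableSet E := measurableSet_le measurable_const (by fun_prop)
  have hlow : Integrable (E.indicator f) := hf.indicator hE
  have hhigh : Integrable (Eᶜ.indicator f) := hf.indicator hE.compl
  have hsmall : ∫ x, ‖Eᶜ.indicator f x‖ ≤ t / 2 := by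
    rw [integral_eq_lintegral_of_nonneg_ae (by filter_upwards with x using norm_nonneg _)
      hhigh.norm.1]
    apply ENNReal.toReal_le_of_le_ofReal (by positivity)
    calc ∫⁻ x, ENNReal.ofReal ‖Eᶜ.indicator f x‖
        ≤ ∫⁻ x, ENNReal.ofReal (t / (2 * B)) * ENNReal.ofReal (‖f x‖ ^ p) := by
          apply lintegral_mono
          intro x
          simp only
          rw [← ENNReal.ofReal_mul (by positivity)]
          apply ENNReal.ofReal_le_ofReal
          by_cases hx : x ∈ E
          · simp [hx]; positivity
          · simp only [mem_compl_iff, hx, not_false_eq_true, indicator_of_mem]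
            rcases (norm_nonneg (f x)).eq_or_lt' with h0 | h0
            · rw [h0]; positivity
            have hx' : 2 * B * ‖f x‖ ^ (1 - p) < t := not_le.1 hx
            have hm : ‖f x‖ = ‖f x‖ ^ (1 - p) * ‖f x‖ ^ p := by
              rw [← Real.rpow_add h0]; simp
            calc ‖f x‖ = ‖f x‖ ^ (1 - p) * ‖f x‖ ^ p := hm
              _ ≤ t / (2 * B) * ‖f x‖ ^ p := by
                gcongr
                rw [le_div_iff₀ (by positivity)]
                linarith
      _ = ENNReal.ofReal (t / (2 * B)) * ∫⁻ x, ENNReal.ofReal (‖f x‖ ^ p) :=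
          lintegral_const_mul _ (by fun_prop)
      _ ≤ ENNReal.ofReal (t / (2 * B)) * ENNReal.ofReal B := by gcongr
      _ = ENNReal.ofReal (t / 2) := by
          rw [← ENNReal.ofReal_mul (by positivity)]
          congr 1
          field_simp
  have hsplit (ξ : ℝ) : ‖𝓕 f ξ‖ ≤ ‖𝓕 (E.indicator f) ξ‖ + t / 2 := by
    have h1 : 𝓕 f ξ = 𝓕 (E.indicator f) ξ + 𝓕 (Eᶜ.indicator f) ξ := by
      have h3 : 𝓕 (E.indicator f + Eᶜ.indicator f) = 𝓕 (E.indicator f) + 𝓕 (Eᶜ.indicator f) :=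
        VectorFourier.fourierIntegral_add Real.continuous_fourierChar
          (by exact continuous_inner) hlow hhigh
      rw [← Pi.add_apply, ← h3, Set.indicator_self_add_compl]
    have h2 : ‖𝓕 (Eᶜ.indicator f) ξ‖ ≤ ∫ x, ‖Eᶜ.indicator f x‖ :=
      VectorFourier.norm_fourierIntegral_le_integral_norm _ _ _ _ _
    rw [h1]
    exact (norm_add_le _ _).trans (by linarith)
  have hcont := continuous_fourier_of_integrable hlow
  calc volume {ξ | t < ‖𝓕 f ξ‖}
      ≤ volume {ξ | ENNReal.ofReal ((t / 2) ^ 2) ≤ ‖𝓕 (E.indicator f) ξ‖ₑ ^ 2} := by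
        apply measure_mono
        intro ξ hξ
        have h1 : t < ‖𝓕 f ξ‖ := hξ
        have h2 := hsplit ξ
        rw [mem_ofPred_eq]
        rw [← ofReal_norm, ← ENNReal.ofReal_pow (norm_nonneg _)]
        apply ENNReal.ofReal_le_ofReal
        gcongr
        linarith
    _ ≤ (∫⁻ ξ, ‖𝓕 (E.indicator f) ξ‖ₑ ^ 2) / ENNReal.ofReal ((t / 2) ^ 2) :=
        meas_ge_le_lintegral_div (by fun_prop) (by simp [ht.ne']) ENNReal.ofReal_ne_top
    _ ≤ (∫⁻ x, ‖E.indicator f x‖ₑ ^ 2) / ENNReal.ofReal ((t / 2) ^ 2) := by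
        exact ENNReal.div_le_div_right (lintegral_enorm_fourier_sq_le hlow) _
    _ = _ := by
        rw [ENNReal.div_eq_inv_mul, ← ENNReal.ofReal_inv_of_pos (by positivity)]
        congr 2
        · field_simp
          norm_num
        · ext x
          by_cases hx : x ∈ E <;> simp [hx]

theorem lintegral_Ioc_rpow {r T : ℝ} (hr : -1 < r) (hT : 0 ≤ T) :
    ∫⁻ t in Ioc 0 T, ENNReal.ofReal (t ^ r) = ENNReal.ofReal (T ^ (r + 1) / (r + 1)) := by
  rw [← ofReal_integral_eq_lintegral_ofReal, ← intervalIntegral.integral_of_le hT,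
    integral_rpow (Or.inl hr), Real.zero_rpow (by linarith), sub_zero]
  · exact (intervalIntegral.intervalIntegrable_rpow' hr).1
  · filter_upwards [ae_restrict_mem measurableSet_Ioc] with t ht
    exact Real.rpow_nonneg ht.1.le _

/-- Qualitative Hausdorff–Young inequality, for exponents `1 < p < 2`. -/
theorem lintegral_fourier_rpow_lt_top_of_lt_two {f : ℝ → ℂ} (hfm : Measurable f)
    (hf : Integrable f) {p q : ℝ} (hp : 1 < p) (hp2 : p < 2) (hq : q = p / (p - 1))
    (hfp : ∫⁻ x, ENNReal.ofReal (‖f x‖ ^ p) < ⊤) :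
    ∫⁻ ξ, ENNReal.ofReal (‖𝓕 f ξ‖ ^ q) < ⊤ := by
  have hp0 : 0 < p - 1 := by linarith
  have hq2 : 0 < q - 2 := by
    rw [hq, sub_pos, lt_div_iff₀ hp0]; linarith
  have hpq : (1 - p) * (q - 2) + 2 = p := by rw [hq]; field_simp; ring
  set B := (∫⁻ x, ENNReal.ofReal (‖f x‖ ^ p)).toReal + 1
  have hB : 0 < B := by positivity
  have hA : ∫⁻ x, ENNReal.ofReal (‖f x‖ ^ p) ≤ ENNReal.ofReal B := by
    rw [← ENNReal.ofReal_toReal hfp.ne]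
    exact ENNReal.ofReal_le_ofReal (by linarith)
  rw [lintegral_rpow_eq_lintegral_meas_lt_mul volume
    (by filter_upwards with ξ using norm_nonneg _)
    (continuous_fourier_of_integrable hf).norm.measurable.aemeasurable (by linarith)]
  refine ENNReal.mul_lt_top ENNReal.ofReal_lt_top ?_
  set E : ℝ → Set ℝ := fun t => {x | t ≤ 2 * B * ‖f x‖ ^ (1 - p)}
  have hjoint : Measurable (Function.uncurry fun t x : ℝ =>
      ENNReal.ofReal (4 * t ^ (q - 3)) * (E t).indicator (fun x => ‖f x‖ₑ ^ 2) x) := by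
    have hset : MeasurableSet {z : ℝ × ℝ | z.1 ≤ 2 * B * ‖f z.2‖ ^ (1 - p)} :=
      measurableSet_le (by fun_prop) (by fun_prop)
    exact Measurable.mul (by fun_prop)
      ((by fun_prop : Measurable fun z : ℝ × ℝ => ‖f z.2‖ₑ ^ 2).indicator hset)
  have hinner (x : ℝ) : ∫⁻ t in Ioi 0,
      ENNReal.ofReal (4 * t ^ (q - 3)) * (E t).indicator (fun x => ‖f x‖ₑ ^ 2) x ≤
      ENNReal.ofReal (4 * (2 * B) ^ (q - 2) / (q - 2)) * ENNReal.ofReal (‖f x‖ ^ p) := by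
    rcases (norm_nonneg (f x)).eq_or_lt' with h0 | h0
    · have h0' : ‖f x‖ₑ = 0 := by simpa using h0
      simp [indicator, h0']
    set T := 2 * B * ‖f x‖ ^ (1 - p) with hT
    have hT0 : 0 ≤ T := by positivity
    calc _ ≤ ∫⁻ t in Ioi 0, (Iic T).indicator
            (fun t => ENNReal.ofReal (4 * ‖f x‖ ^ 2) * ENNReal.ofReal (t ^ (q - 3))) t := by
          apply setLIntegral_mono' measurableSet_Ioi
          intro t ht
          have ht0 : 0 < t := ht
          by_cases h : t ≤ T
          · rw [indicator_of_mem (show x ∈ E t from h), indicator_of_mem (show t ∈ Iic T from h),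
              ← ofReal_norm, ← ENNReal.ofReal_pow (norm_nonneg _),
              ← ENNReal.ofReal_mul (by positivity), ← ENNReal.ofReal_mul (by positivity)]
            exact ENNReal.ofReal_le_ofReal (by linarith)
          · rw [indicator_of_notMem (show x ∉ E t from h)]
            simp
      _ = ENNReal.ofReal (4 * ‖f x‖ ^ 2) * ∫⁻ t in Ioc 0 T, ENNReal.ofReal (t ^ (q - 3)) := by
          rw [setLIntegral_indicator measurableSet_Iic, Iic_inter_Ioi,
            lintegral_const_mul _ (by fun_prop)]
      _ = _ := by
          rw [lintegral_Ioc_rpow (by linarith) hT0, ← ENNReal.ofReal_mul (by positivity),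
            ← ENNReal.ofReal_mul (by positivity)]
          congr 1
          rw [show q - 3 + 1 = q - 2 by ring, hT, Real.mul_rpow (by positivity) (by positivity),
            ← Real.rpow_mul h0.le]
          have h2 : ‖f x‖ ^ p = ‖f x‖ ^ ((1 - p) * (q - 2)) * ‖f x‖ ^ 2 := by
            rw [← Real.rpow_natCast, ← Real.rpow_add h0]
            push_cast
            rw [hpq]
          rw [h2]
          ring
  calc _ ≤ ∫⁻ t in Ioi 0, ∫⁻ x,
          ENNReal.ofReal (4 * t ^ (q - 3)) * (E t).indicator (fun x => ‖f x‖ₑ ^ 2) x := by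
        apply setLIntegral_mono' measurableSet_Ioi
        intro t ht
        have ht0 : 0 < t := ht
        have hEt : Measurable ((E t).indicator (fun x => ‖f x‖ₑ ^ 2)) :=
          (by fun_prop : Measurable fun x => ‖f x‖ₑ ^ 2).indicator
            (measurableSet_le measurable_const (by fun_prop))
        rw [lintegral_const_mul _ hEt]
        have hw : ENNReal.ofReal (4 * t ^ (q - 3)) =
            ENNReal.ofReal (4 / t ^ 2) * ENNReal.ofReal (t ^ (q - 1)) := by
          rw [← ENNReal.ofReal_mul (by positivity)]
          congr 1
          rw [show q - 1 = q - 3 + (2 : ℕ) by push_cast; ring, Real.rpow_add_natCast ht0.ne']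
          field_simp
        rw [hw, mul_right_comm]
        gcongr
        exact measure_lt_norm_fourier_le hfm hf hp hB hA ht0
    _ = ∫⁻ x, ∫⁻ t in Ioi 0,
          ENNReal.ofReal (4 * t ^ (q - 3)) * (E t).indicator (fun x => ‖f x‖ₑ ^ 2) x :=
        lintegral_lintegral_swap hjoint.aemeasurable
    _ ≤ ∫⁻ x, ENNReal.ofReal (4 * (2 * B) ^ (q - 2) / (q - 2)) * ENNReal.ofReal (‖f x‖ ^ p) :=
        lintegral_mono hinner
    _ = ENNReal.ofReal (4 * (2 * B) ^ (q - 2) / (q - 2)) * ∫⁻ x, ENNReal.ofReal (‖f x‖ ^ p) :=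
        lintegral_const_mul _ (by fun_prop)
    _ < ⊤ := ENNReal.mul_lt_top ENNReal.ofReal_lt_top hfp

/-- Qualitative Hausdorff–Young inequality: the Fourier transform of a function in `L¹ ∩ Lᵖ`,
`1 < p ≤ 2`, belongs to `L^q` for the conjugate exponent `q`. -/
theorem lintegral_fourier_rpow_lt_top {f : ℝ → ℂ} (hf : Integrable f) {p q : ℝ} (hp : 1 < p)
    (hp2 : p ≤ 2) (hq : q = p / (p - 1)) (hfp : ∫⁻ x, ENNReal.ofReal (‖f x‖ ^ p) < ⊤) :
    ∫⁻ ξ, ENNReal.ofReal (‖𝓕 f ξ‖ ^ q) < ⊤ := by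
  obtain ⟨g, hgm, hfg⟩ := hf.1
  have hF : 𝓕 f = 𝓕 g := funext fun ξ => Real.fourier_congr_ae hfg ξ
  have hgp : ∫⁻ x, ENNReal.ofReal (‖g x‖ ^ p) < ⊤ := by
    exact (lintegral_congr_ae (hfg.fun_comp fun z => ENNReal.ofReal (‖z‖ ^ p))).symm.trans_lt hfp
  rw [hF]
  have hg := hf.congr hfg
  rcases hp2.lt_or_eq with hlt | rfl
  · exact lintegral_fourier_rpow_lt_top_of_lt_two hgm.measurable hg hp hlt hq hgp
  · obtain rfl : q = 2 := by rw [hq]; norm_num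
    have hsq (z : ℂ) : ENNReal.ofReal (‖z‖ ^ (2 : ℝ)) = ‖z‖ₑ ^ 2 := by
      rw [← ofReal_norm, ← ENNReal.ofReal_pow (norm_nonneg _), Real.rpow_two]
    simp only [hsq] at hgp ⊢
    exact (lintegral_enorm_fourier_sq_le hg).trans_lt hgp

/-- Logarithmic change of variables. -/
theorem setLIntegral_Ioi_inv_mul_comp_log (c : ℝ) (hc : 0 < c) (g : ℝ → ENNReal) :
    ∫⁻ x in Ioi 0, ENNReal.ofReal x⁻¹ * g (Real.log x / c) =
      ENNReal.ofReal c * ∫⁻ u, g u := by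
  have himg : (fun u : ℝ => Real.exp (c * u)) '' univ = Ioi 0 := by
    ext x
    simp only [image_univ, mem_range, mem_Ioi]
    refine ⟨fun ⟨u, hu⟩ => hu ▸ Real.exp_pos _, fun hx => ⟨Real.log x / c, ?_⟩⟩
    rw [mul_div_cancel₀ _ hc.ne', Real.exp_log hx]
  rw [← himg, lintegral_image_eq_lintegral_abs_deriv_mul (f' := fun u => Real.exp (c * u) * c)
    MeasurableSet.univ, setLIntegral_univ, ← lintegral_const_mul' _ _ ENNReal.ofReal_ne_top]
  · congr 1 with u
    rw [Real.log_exp, mul_div_cancel_left₀ _ hc.ne', ← mul_assoc,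
      ← ENNReal.ofReal_mul (abs_nonneg _), abs_of_pos (by positivity)]
    congr 2
    field_simp
  · intro u _
    simpa using ((hasDerivAt_id u).const_mul c).exp
  · intro u _ v _ huv
    exact mul_left_cancel₀ hc.ne' (Real.exp_injective huv)

theorem integral_mul_cpow_eq_fourier (G : ℝ → ℂ) {x : ℝ} (hx : 0 < x) :
    ∫ ν : ℝ, G ν * (x : ℂ) ^ (-(ν : ℂ) * Complex.I) = 𝓕 G (Real.log x / (2 * Real.pi)) := by
  rw [Real.fourier_real_eq_integral_exp_smul]
  congr 1 with ν
  rw [smul_eq_mul, mul_comm, Complex.cpow_def_of_ne_zero (by exact_mod_cast hx.ne'),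
    ← Complex.ofReal_log hx.le]
  congr 2
  have := Real.pi_ne_zero
  push_cast
  field_simp

/-- Integrability claim of part II of the Proposition (Random lines): if
`ν ↦ (h*/φ*)(μ+iν) ∈ L^p`, `p ∈ (1,2]`, then `λ ↦ λ² H(λ)` lies in the
weighted space `L^q_{{μ}}(ℝ₊)`, `q = p/(p−1)`. -/
theorem line_solution_Lq (lm β : ℝ) (hlm : 0 < lm) (hβ : 0 < β)
    (h φ : ℝ → ℝ)
    (hh_meas : Measurable h)
    (hh_nn : ∀ᵐ x : ℝ, 0 ≤ h x)
    (hh_one : (∫ x : ℝ, h x) = 1)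
    (hh_supp : ∀ᵐ x : ℝ, x ∉ Set.Icc 0 lm → h x = 0)
    (hφ_meas : Measurable φ)
    (hφ_nn : ∀ᵐ x : ℝ, 0 ≤ φ x)
    (hφ_one : (∫ x : ℝ, φ x) = 1)
    (hφ_supp : ∀ᵐ x : ℝ, x ∉ Set.Icc 0 lm → φ x = 0)
    (μ : ℝ) (hμ : 1 < μ)
    (hφne : ∀ ν : ℝ, mellinT lm φ ((μ : ℂ) + ν * Complex.I) ≠ 0)
    (hL1h : Integrable (fun ν : ℝ => mellinT lm h ((μ : ℂ) + ν * Complex.I)))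
    (hL1q : Integrable (fun ν : ℝ =>
      mellinT lm h ((μ : ℂ) + ν * Complex.I) / mellinT lm φ ((μ : ℂ) + ν * Complex.I)))
    (p : ℝ) (hp1 : 1 < p) (hp2 : p ≤ 2)
    (hLp : (∫⁻ ν : ℝ, ENNReal.ofReal
      (‖mellinT lm h ((μ : ℂ) + ν * Complex.I) /
          mellinT lm φ ((μ : ℂ) + ν * Complex.I)‖ ^ p)) < ⊤)
    (q : ℝ) (hq : q = p / (p - 1))
    (H : ℝ → ℂ)
    (hH : ∀ lam : ℝ, 0 < lam → H lam =
      ((1 / (β * lam ^ 2) * (lam ^ (-μ) / (2 * Real.pi)) : ℝ) : ℂ) *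
        ∫ ν : ℝ, (mellinT lm h ((μ : ℂ) + ν * Complex.I) /
            mellinT lm φ ((μ : ℂ) + ν * Complex.I)) *
          (lam : ℂ) ^ (-(ν : ℂ) * Complex.I)) :
    (∫⁻ lam in Set.Ioi (0 : ℝ), ENNReal.ofReal
      (lam ^ (μ * q - 1) * ‖((lam ^ 2 : ℝ) : ℂ) * H lam‖ ^ q)) < ⊤ := by
  set G : ℝ → ℂ := fun ν => mellinT lm h ((μ : ℂ) + ν * Complex.I) /
    mellinT lm φ ((μ : ℂ) + ν * Complex.I)
  have hq0 : 0 < q := by rw [hq]; exact div_pos (by linarith) (by linarith)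
  have hHY := lintegral_fourier_rpow_lt_top hL1q hp1 hp2 hq hLp
  set C : ℝ := 1 / (β * (2 * Real.pi))
  have hC : 0 ≤ C := by positivity
  have hpt (x : ℝ) (hx : 0 < x) : x ^ (μ * q - 1) * ‖((x ^ 2 : ℝ) : ℂ) * H x‖ ^ q =
      C ^ q * (x⁻¹ * ‖𝓕 G (Real.log x / (2 * Real.pi))‖ ^ q) := by
    have hnorm : ‖((x ^ 2 : ℝ) : ℂ) * H x‖ =
        C * x ^ (-μ) * ‖𝓕 G (Real.log x / (2 * Real.pi))‖ := by
      rw [hH x hx, integral_mul_cpow_eq_fourier G hx, ← mul_assoc, ← Complex.ofReal_mul, norm_mul,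
        Complex.norm_real, Real.norm_of_nonneg (by positivity)]
      congr 1
      simp only [C]
      field_simp
    have hxq : x ^ (μ * q - 1) * (x ^ (-μ)) ^ q = x⁻¹ := by
      rw [← Real.rpow_mul hx.le, ← Real.rpow_add hx, ← Real.rpow_neg_one]
      ring_nf
    rw [hnorm, Real.mul_rpow (by positivity) (norm_nonneg _), Real.mul_rpow hC (by positivity),
      ← hxq]
    ring
  calc _ = ∫⁻ x in Ioi 0, ENNReal.ofReal (C ^ q) * (ENNReal.ofReal x⁻¹ *
          ENNReal.ofReal (‖𝓕 G (Real.log x / (2 * Real.pi))‖ ^ q)) := by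
        apply setLIntegral_congr_fun measurableSet_Ioi
        intro x hx
        have hx0 : 0 < x := hx
        simp only
        rw [hpt x hx0, ENNReal.ofReal_mul (by positivity), ENNReal.ofReal_mul (by positivity)]
    _ = ENNReal.ofReal (C ^ q) * (ENNReal.ofReal (2 * Real.pi) *
          ∫⁻ u, ENNReal.ofReal (‖𝓕 G u‖ ^ q)) := by
        rw [lintegral_const_mul' _ _ ENNReal.ofReal_ne_top,
          setLIntegral_Ioi_inv_mul_comp_log _ (by positivity)
            (fun u => ENNReal.ofReal (‖𝓕 G u‖ ^ q))]
    _ < ⊤ := ENNReal.mul_lt_top ENNReal.ofReal_lt_top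
        (ENNReal.mul_lt_top ENNReal.ofReal_lt_top hHY)
end

section
/- Let β > 0 and let h : (0, ∞) → ℝ be continuously differentiable with h(l) = 0 for all l ≥ 2. Define H(λ) = −(1/β) · d/dλ [h(2λ)/λ] for λ > 0. Then for every l ∈ (0, 2], β ∫_{l/2}^∞ λ · (l/(2λ)) · H(λ) dλ = h(l); equivalently, ∫_{l/2}^∞ H(λ) dλ = 2 h(l) / (β l) for all l ∈ (0, 2]. -/
open MeasureTheory Set

/-- The fundamental theorem of calculus on `(c, ∞)` for a function that is `C¹` on `(0, ∞)`
and vanishes from some point on. -/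
lemma integral_Ioi_deriv_eq_neg_of_contDiffOn {g : ℝ → ℝ} {b c : ℝ}
    (hg : ContDiffOn ℝ 1 g (Ioi 0)) (hgb : ∀ t, b ≤ t → g t = 0) (hc : 0 < c) (hcb : c ≤ b) :
    ∫ t in Ioi c, deriv g t = -g c := by
  have hderiv : ∀ t, 0 < t → HasDerivAt g (deriv g t) t := fun t ht =>
    ((hg.differentiableOn one_ne_zero).differentiableAt (Ioi_mem_nhds ht)).hasDerivAt
  have hzero : ∀ t ∈ Ioi b, deriv g t = 0 := by
    intro t ht
    have hev : g =ᶠ[nhds t] fun _ => (0 : ℝ) := by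
      filter_upwards [Ioi_mem_nhds ht] with s hs using hgb s (le_of_lt hs)
    rw [hev.deriv_eq, deriv_const]
  have hint : IntegrableOn (deriv g) (Ioi c) := by
    rw [← Ioc_union_Ioi_eq_Ioi hcb]
    refine IntegrableOn.union ?_ ?_
    · refine (ContinuousOn.integrableOn_Icc ?_).mono_set Ioc_subset_Icc_self
      exact (hg.continuousOn_deriv_of_isOpen isOpen_Ioi le_rfl).mono
        fun t ht => lt_of_lt_of_le hc ht.1
    · exact integrableOn_zero.congr_fun (fun t ht => (hzero t ht).symm) measurableSet_Ioi
  have hlim : Filter.Tendsto g Filter.atTop (nhds 0) := by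
    refine tendsto_const_nhds.congr' ?_
    filter_upwards [Filter.eventually_ge_atTop b] with t ht using (hgb t ht).symm
  rw [integral_Ioi_of_hasDerivAt_of_tendsto (hderiv c hc).continuousAt.continuousWithinAt
    (fun t ht => hderiv t (hc.trans ht)) hint hlim, zero_sub]

/-- Spherical random-line case: the closed-form solution
`H(λ) = −(1/β) (h(2λ)/λ)'` solves the chord-length equation
`β ∫_{l/2}^∞ λ (l/(2λ)) H(λ) dλ = h(l)`, i.e. `∫_{l/2}^∞ H(λ) dλ = 2h(l)/(βl)`. -/
theorem spherical_line_closed_form (β : ℝ) (hβ : 0 < β) (h : ℝ → ℝ)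
    (hsm : ContDiffOn ℝ 1 h (Set.Ioi 0))
    (hz : ∀ l : ℝ, 2 ≤ l → h l = 0)
    (H : ℝ → ℝ)
    (hH : ∀ lam : ℝ, 0 < lam →
      H lam = -(1 / β) * deriv (fun t : ℝ => h (2 * t) / t) lam) :
    ∀ l : ℝ, 0 < l → l ≤ 2 →
      (β * (∫ lam in Set.Ioi (l / 2), lam * (l / (2 * lam)) * H lam) = h l ∧
       (∫ lam in Set.Ioi (l / 2), H lam) = 2 * h l / (β * l)) := by
  intro l hl hl2
  have hg : ContDiffOn ℝ 1 (fun t : ℝ => h (2 * t) / t) (Ioi 0) := by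
    refine ContDiffOn.div ?_ contDiffOn_id fun t ht => ne_of_gt ht
    refine hsm.comp (by fun_prop) fun t ht => ?_
    exact mul_pos two_pos (mem_Ioi.mp ht)
  have hH_integral : ∫ lam in Ioi (l / 2), H lam = 2 * h l / (β * l) := by
    rw [setIntegral_congr_fun measurableSet_Ioi
      (fun t ht => hH t ((half_pos hl).trans ht)), integral_const_mul,
      integral_Ioi_deriv_eq_neg_of_contDiffOn (b := 1) hg
        (fun t ht => by rw [hz (2 * t) (by linarith), zero_div]) (half_pos hl) (by linarith),
      mul_div_cancel₀ l two_ne_zero]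
    field_simp
  refine ⟨?_, hH_integral⟩
  have hkernel : EqOn (fun lam => lam * (l / (2 * lam)) * H lam)
      (fun lam => l / 2 * H lam) (Ioi (l / 2)) := by
    intro t ht
    have ht0 : t ≠ 0 := ((half_pos hl).trans ht).ne'
    simp only
    field_simp
  rw [setIntegral_congr_fun measurableSet_Ioi hkernel, integral_const_mul, hH_integral]
  field_simp
end

section
/- Define h(l) = 1 − |l − 1| for l ∈ [0, 2] and h(l) = 0 otherwise; define φ(z) = z/2 for z ∈ [0, 2] and φ(z) = 0 otherwise; and define H(λ) = 2/λ² for λ ∈ [1/2, 1] and H(λ) = 0 otherwise. Then for every l ∈ (0, 2], ∫_{l/2}^∞ λ φ(l/λ) H(λ) dλ = h(l). Explicitly, ∫_{max(l/2, 1/2)}^1 λ · (l/(2λ)) · (2/λ²) dλ = 1 − |l − 1|. -/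
open MeasureTheory Set

theorem setIntegral_Ioo_mul_inv_sq {a b : ℝ} (l : ℝ) (ha : 0 < a) (hab : a ≤ b) :
    ∫ x in Ioo a b, l * (x ^ 2)⁻¹ = l * (a⁻¹ - b⁻¹) := by
  rw [← integral_Ioc_eq_integral_Ioo, ← intervalIntegral.integral_of_le hab]
  have pos : ∀ x ∈ uIcc a b, x ≠ 0 := fun x hx => by
    rw [uIcc_of_le hab] at hx
    exact (ha.trans_le hx.1).ne'
  have hderiv : ∀ x ∈ uIcc a b, HasDerivAt (fun y : ℝ => l * -y⁻¹) (l * (x ^ 2)⁻¹) x :=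
    fun x hx => by simpa using ((hasDerivAt_inv (pos x hx)).neg.const_mul l)
  have hcont : ContinuousOn (fun x : ℝ => l * (x ^ 2)⁻¹) (uIcc a b) :=
    continuousOn_const.mul ((continuousOn_id.pow 2).inv₀ fun x hx => pow_ne_zero 2 (pos x hx))
  rw [intervalIntegral.integral_eq_sub_of_hasDerivAt hderiv hcont.intervalIntegrable]
  ring

/-- Spherical random-line case with triangular chord-length density:
the particle-size density `2/λ²` on `[1/2, 1]` solves the equation
`∫_{l/2}^∞ λ φ(l/λ) H(λ) dλ = 1 − |l − 1|` for `l ∈ (0, 2]`, and explicitly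
`∫_{max(l/2,1/2)}^1 λ (l/(2λ)) (2/λ²) dλ = 1 − |l − 1|`. -/
theorem spherical_line_triangle (h φ H : ℝ → ℝ)
    (hh1 : ∀ l ∈ Set.Icc (0 : ℝ) 2, h l = 1 - |l - 1|)
    (hh2 : ∀ l : ℝ, l ∉ Set.Icc (0 : ℝ) 2 → h l = 0)
    (hφ1 : ∀ z ∈ Set.Icc (0 : ℝ) 2, φ z = z / 2)
    (hφ2 : ∀ z : ℝ, z ∉ Set.Icc (0 : ℝ) 2 → φ z = 0)
    (hH1 : ∀ lam ∈ Set.Icc (1 / 2 : ℝ) 1, H lam = 2 / lam ^ 2)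
    (hH2 : ∀ lam : ℝ, lam ∉ Set.Icc (1 / 2 : ℝ) 1 → H lam = 0) :
    ∀ l : ℝ, 0 < l → l ≤ 2 →
      ((∫ lam in Set.Ioi (l / 2), lam * φ (l / lam) * H lam) = h l ∧
       (∫ lam in Set.Ioo (max (l / 2) (1 / 2)) 1,
          lam * (l / (2 * lam)) * (2 / lam ^ 2)) = 1 - |l - 1|) := by
  intro l hl0 hl2
  have hm0 : 0 < max (l / 2) (1 / 2) := lt_max_of_lt_right (by norm_num)
  have hm1 : max (l / 2) (1 / 2) ≤ 1 := max_le (by linarith) (by norm_num)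
  have explicit : (∫ lam in Ioo (max (l / 2) (1 / 2)) 1,
      lam * (l / (2 * lam)) * (2 / lam ^ 2)) = 1 - |l - 1| := by
    have hcongr : EqOn (fun lam : ℝ => lam * (l / (2 * lam)) * (2 / lam ^ 2))
        (fun lam => l * (lam ^ 2)⁻¹) (Ioo (max (l / 2) (1 / 2)) 1) := fun x hx => by
      have : x ≠ 0 := (hm0.trans hx.1).ne'
      simp only
      field_simp
    rw [setIntegral_congr_fun measurableSet_Ioo hcongr, setIntegral_Ioo_mul_inv_sq l hm0 hm1]
    rcases le_total l 1 with h1 | h1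
    · rw [max_eq_right (by linarith), abs_of_nonpos (by linarith)]
      norm_num
    · rw [max_eq_left (by linarith), abs_of_nonneg (by linarith)]
      field_simp
      ring
  refine ⟨?_, explicit⟩
  rw [hh1 l ⟨hl0.le, hl2⟩, ← explicit]
  have hsub : Ioo (max (l / 2) (1 / 2)) 1 ⊆ Ioi (l / 2) :=
    fun x hx => (le_max_left _ _).trans_lt hx.1
  rw [setIntegral_eq_of_subset_of_ae_sdiff_eq_zero measurableSet_Ioi.nullMeasurableSet hsub]
  · refine setIntegral_congr_fun measurableSet_Ioo fun x hx => ?_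
    have hx0 : 0 < x := hm0.trans hx.1
    have hxl : l / 2 < x := hsub hx
    rw [hφ1 _ ⟨by positivity, by rw [div_le_iff₀ hx0]; linarith⟩,
      hH1 x ⟨((le_max_right _ _).trans_lt hx.1).le, hx.2.le⟩, div_div, mul_comm x 2]
  · filter_upwards [Measure.ae_ne volume (1 / 2 : ℝ), Measure.ae_ne volume (1 : ℝ)]
      with x hx1 hx2 hx
    rw [hH2 x fun hmem => hx.2 ⟨max_lt hx.1 (hmem.1.lt_of_ne' hx1), hmem.2.lt_of_ne hx2⟩,
      mul_zero]
end

section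
/- Define h(l) = (3/8)(2 − l)² for l ∈ [0, 2] and h(l) = 0 otherwise; define φ(z) = z/2 for z ∈ [0, 2] and φ(z) = 0 otherwise; and define H(λ) = 3(1 − λ²)/(2λ²) for λ ∈ (0, 1] and H(λ) = 0 otherwise. Then for every l ∈ (0, 2], ∫_{l/2}^∞ λ φ(l/λ) H(λ) dλ = h(l). Explicitly, (3l/4) ∫_{l/2}^1 (λ^{−2} − 1) dλ = (3/8)(2 − l)². -/
open MeasureTheory Set

/-- The integral of `x⁻² - 1` over `(a, 1)`, from its antiderivative `-x⁻¹ - x`. -/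
theorem setIntegral_Ioo_inv_sq_sub_one {a : ℝ} (ha : 0 < a) (ha1 : a ≤ 1) :
    ∫ x in Set.Ioo a 1, ((x ^ 2)⁻¹ - 1) = a⁻¹ + a - 2 := by
  rw [← integral_Ioc_eq_integral_Ioo, ← intervalIntegral.integral_of_le ha1]
  have hpos : ∀ x ∈ Set.uIcc a 1, x ≠ 0 := fun x hx => by
    rw [Set.uIcc_of_le ha1] at hx
    exact (ha.trans_le hx.1).ne'
  have hderiv : ∀ x ∈ Set.uIcc a 1,
      HasDerivAt (fun y : ℝ => -y⁻¹ - y) ((x ^ 2)⁻¹ - 1) x := fun x hx => by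
    simpa using (hasDerivAt_inv (hpos x hx)).fun_neg.fun_sub (hasDerivAt_id' x)
  have hcont : ContinuousOn (fun x : ℝ => (x ^ 2)⁻¹ - 1) (Set.uIcc a 1) :=
    ((continuousOn_id.pow 2).inv₀ fun x hx => pow_ne_zero 2 (hpos x hx)).sub continuousOn_const
  rw [intervalIntegral.integral_eq_sub_of_hasDerivAt hderiv hcont.intervalIntegrable]
  ring

/-- Spherical random-line case with quadratic chord-length density:
the particle-size function `3(1 − λ²)/(2λ²)` on `(0, 1]` solves the equation
`∫_{l/2}^∞ λ φ(l/λ) H(λ) dλ = (3/8)(2 − l)²` for `l ∈ (0, 2]`, and explicitly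
`(3l/4) ∫_{l/2}^1 (λ⁻² − 1) dλ = (3/8)(2 − l)²`. -/
theorem spherical_line_quadratic (h φ H : ℝ → ℝ)
    (hh1 : ∀ l ∈ Set.Icc (0 : ℝ) 2, h l = 3 / 8 * (2 - l) ^ 2)
    (hh2 : ∀ l : ℝ, l ∉ Set.Icc (0 : ℝ) 2 → h l = 0)
    (hφ1 : ∀ z ∈ Set.Icc (0 : ℝ) 2, φ z = z / 2)
    (hφ2 : ∀ z : ℝ, z ∉ Set.Icc (0 : ℝ) 2 → φ z = 0)
    (hH1 : ∀ lam ∈ Set.Ioc (0 : ℝ) 1, H lam = 3 * (1 - lam ^ 2) / (2 * lam ^ 2))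
    (hH2 : ∀ lam : ℝ, lam ∉ Set.Ioc (0 : ℝ) 1 → H lam = 0) :
    ∀ l : ℝ, 0 < l → l ≤ 2 →
      ((∫ lam in Set.Ioi (l / 2), lam * φ (l / lam) * H lam) = h l ∧
       3 * l / 4 * (∫ lam in Set.Ioo (l / 2) 1, ((lam ^ 2)⁻¹ - 1)) =
         3 / 8 * (2 - l) ^ 2) := by
  intro l hl hl2
  have explicit : 3 * l / 4 * (∫ lam in Set.Ioo (l / 2) 1, ((lam ^ 2)⁻¹ - 1)) =
      3 / 8 * (2 - l) ^ 2 := by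
    rw [setIntegral_Ioo_inv_sq_sub_one (by linarith) (by linarith)]
    field_simp
    ring
  refine ⟨?_, explicit⟩
  have hsub : Set.Ioc (l / 2) 1 ⊆ Set.Ioi (l / 2) := fun _ hx => hx.1
  rw [hh1 l ⟨hl.le, hl2⟩, ← explicit, ← integral_const_mul, ← integral_Ioc_eq_integral_Ioo,
    setIntegral_eq_of_subset_of_forall_sdiff_eq_zero measurableSet_Ioi hsub]
  · refine setIntegral_congr_fun measurableSet_Ioc fun x hx => ?_
    have hx0 : 0 < x := (half_pos hl).trans hx.1
    have hz : l / x ≤ 2 := by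
      rw [div_le_iff₀ hx0]
      linarith [hx.1]
    rw [hφ1 (l / x) ⟨by positivity, hz⟩, hH1 x ⟨hx0, hx.2⟩]
    field_simp
    ring
  · intro x hx
    rw [hH2 x fun h1 => hx.2 ⟨hx.1, h1.2⟩, mul_zero]
end
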